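/- Let (f⁺, f⁻) be a Vickrey queue flow for an arc with transit time τ > 0 and capacity ν > 0, and let ζ ≥ 0. Define the last regeneration point ζ' := sup{ ξ ∈ [0, ζ] : z(ξ + τ) = 0 } (the set is nonempty since z(τ) = 0). Then z(ζ' + τ) = 0, F⁻(ζ' + τ) = F⁺(ζ'), and the outflow operates at capacity throughout the queueing interval: F⁻(ζ + τ) = F⁻(ζ' + τ) + ν·(ζ − ζ'). -/

import Mathlib

open MeasureTheory

/-- The cumulative function `F(θ) = ∫₀^θ f(ξ) dξ` of a rate function `f`. -/
noncomputable def cumul (f : ℝ → ℝ) (θ : ℝ) : ℝ := ∫ ξ in (0:ℝ)..θ, f ξ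

/-- A Vickrey queue flow for an arc with transit time `τ` and capacity `ν`: a pair
`(fi, fo)` of nonnegative, bounded, locally integrable inflow/outflow rates vanishing on
`(−∞, 0)`, whose queue size `z(θ) = F⁺(θ − τ) − F⁻(θ)` is nonnegative, and such that for
almost every `θ`: `fo θ = ν` if `z θ > 0`, and `fo θ = min (fi (θ − τ)) ν` if `z θ = 0`. -/
def IsVickreyFlow (τ ν : ℝ) (fi fo : ℝ → ℝ) : Prop :=
  (∀ θ, 0 ≤ fi θ) ∧ (∀ θ, 0 ≤ fo θ) ∧
  (∃ M : ℝ, ∀ θ, fi θ ≤ M ∧ fo θ ≤ M) ∧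
  LocallyIntegrable fi ∧ LocallyIntegrable fo ∧
  (∀ θ < (0:ℝ), fi θ = 0) ∧ (∀ θ < (0:ℝ), fo θ = 0) ∧
  (∀ θ : ℝ, 0 ≤ cumul fi (θ - τ) - cumul fo θ) ∧
  (∀ᵐ θ : ℝ ∂volume,
    (0 < cumul fi (θ - τ) - cumul fo θ → fo θ = ν) ∧
    (cumul fi (θ - τ) - cumul fo θ = 0 → fo θ = min (fi (θ - τ)) ν))


theorem intervalIntegrable_of_locallyIntegrable {f : ℝ → ℝ} (hf : LocallyIntegrable f) (a b : ℝ) :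
    IntervalIntegrable f volume a b :=
  (hf.integrableOn_isCompact isCompact_uIcc).intervalIntegrable

theorem continuous_cumul {f : ℝ → ℝ} (hf : LocallyIntegrable f) : Continuous (cumul f) :=
  intervalIntegral.continuous_primitive (intervalIntegrable_of_locallyIntegrable hf) 0

theorem cumul_sub_cumul {f : ℝ → ℝ} (hf : LocallyIntegrable f) (a b : ℝ) :
    cumul f b - cumul f a = ∫ ξ in a..b, f ξ :=
  intervalIntegral.integral_interval_sub_left (intervalIntegrable_of_locallyIntegrable hf 0 b)
    (intervalIntegrable_of_locallyIntegrable hf 0 a)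

/-- If `f` equals the constant `c` almost everywhere on `(a, b]`, then its cumulative function
grows linearly with slope `c` from `a` to `b`. -/
theorem cumul_eq_add_mul {f : ℝ → ℝ} (hf : LocallyIntegrable f) {a b c : ℝ} (hab : a ≤ b)
    (h : ∀ᵐ θ : ℝ, θ ∈ Set.Ioc a b → f θ = c) : cumul f b = cumul f a + c * (b - a) := by
  have hint : ∫ ξ in a..b, f ξ = ∫ _ in a..b, c :=
    intervalIntegral.integral_congr_ae (by rwa [Set.uIoc_of_le hab])
  rw [intervalIntegral.integral_const, smul_eq_mul, ← cumul_sub_cumul hf] at hint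
  linarith

/-- The queue of a Vickrey flow is empty at time `τ`. -/
theorem IsVickreyFlow.queue_transit_eq_zero {τ ν : ℝ} {fi fo : ℝ → ℝ} (hτ : 0 ≤ τ)
    (hV : IsVickreyFlow τ ν fi fo) : cumul fi 0 - cumul fo (0 + τ) = 0 := by
  obtain ⟨-, hfo, -, -, -, -, -, hz, -⟩ := hV
  have hi : cumul fi 0 = 0 := intervalIntegral.integral_same
  have ho : 0 ≤ cumul fo τ := intervalIntegral.integral_nonneg_of_forall hτ hfo
  have hzτ := hz τ
  rw [sub_self] at hzτ
  rw [zero_add]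
  linarith

/-- **Regeneration point.** For a Vickrey queue flow and `ζ ≥ 0`, the last regeneration
point `ζ' = sup{ ξ ∈ [0, ζ] : z(ξ + τ) = 0 }` satisfies `z(ζ' + τ) = 0`,
`F⁻(ζ' + τ) = F⁺(ζ')`, and the outflow operates at capacity throughout the queueing
interval: `F⁻(ζ + τ) = F⁻(ζ' + τ) + ν·(ζ − ζ')`. -/
theorem regeneration_point (τ ν : ℝ) (hτ : 0 < τ) (hν : 0 < ν)
    (fi fo : ℝ → ℝ) (hV : IsVickreyFlow τ ν fi fo)
    (ζ : ℝ) (hζ : 0 ≤ ζ) (ζ' : ℝ)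
    (hζ' : ζ' = sSup {ξ : ℝ | ξ ∈ Set.Icc 0 ζ ∧ cumul fi ξ - cumul fo (ξ + τ) = 0}) :
    cumul fi ζ' - cumul fo (ζ' + τ) = 0 ∧
    cumul fo (ζ' + τ) = cumul fi ζ' ∧
    cumul fo (ζ + τ) = cumul fo (ζ' + τ) + ν * (ζ - ζ') := by
  set S := {ξ : ℝ | ξ ∈ Set.Icc 0 ζ ∧ cumul fi ξ - cumul fo (ξ + τ) = 0}
  have hS0 : S.Nonempty := ⟨0, ⟨le_rfl, hζ⟩, hV.queue_transit_eq_zero hτ.le⟩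
  obtain ⟨-, -, -, hfi, hfo, -, -, hz, hae⟩ := hV
  have hcont : Continuous fun ξ => cumul fi ξ - cumul fo (ξ + τ) :=
    (continuous_cumul hfi).sub ((continuous_cumul hfo).comp (continuous_id.add continuous_const))
  have hcompact : IsCompact S := isCompact_Icc.inter_right (isClosed_eq hcont continuous_const)
  obtain ⟨⟨h0, hle⟩, hempty⟩ : ζ' ∈ S := hζ' ▸ hcompact.sSup_mem hS0
  refine ⟨hempty, (sub_eq_zero.mp hempty).symm, ?_⟩
  have hcap : ∀ᵐ θ : ℝ, θ ∈ Set.Ioc (ζ' + τ) (ζ + τ) → fo θ = ν := by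
    filter_upwards [hae] with θ hθ hmem
    refine hθ.1 ((hz θ).lt_of_ne' fun hzero => ?_)
    have hθS : θ - τ ∈ S :=
      ⟨⟨by linarith [hmem.1], by linarith [hmem.2]⟩, by rwa [sub_add_cancel]⟩
    have := le_csSup hcompact.bddAbove hθS
    linarith [hmem.1]
  rw [cumul_eq_add_mul hfo (by linarith) hcap, add_sub_add_right_eq_sub]
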